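/- arXiv:math/0106135 — 2 statements merged into one kernel-verified Lean document; each statement's English description precedes it below -/
import Mathlib

section
/- For every n ≥ 1 and every p with 1 ≤ p ≤ n, the polynomial Σ_{i₁+⋯+i_p = n−p+1, i_j ≥ 0} x_{n−p+1}^{2i_p} x_{n−p+2}^{2i_{p−1}} ⋯ xₙ^{2i_1} — that is, the complete homogeneous symmetric polynomial h_{n−p+1} evaluated at the squares x_{n−p+1}², …, xₙ² — belongs to the ideal J. -/
open MvPolynomial

/-- The complete homogeneous symmetric polynomial of degree `m` evaluated at
the squares of the variables `X i` for `i ∈ S`: the sum, over all multisets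
of size `m` of variables from `S`, of the product of their squares. -/
noncomputable def completeHomoSq (n : ℕ) (S : Finset (Fin n)) (m : ℕ) :
    MvPolynomial (Fin n) ℝ :=
  ∑ μ : Sym {i // i ∈ S} m, ((μ : Multiset {i // i ∈ S}).map
    (fun i => (X (i : Fin n) : MvPolynomial (Fin n) ℝ) ^ 2)).prod

/-- The ideal `J` generated by `e_j(x₁², …, xₙ²)` for `1 ≤ j ≤ n`, the
elementary symmetric polynomials evaluated at the squares of the variables. -/
noncomputable def sqSymIdeal (n : ℕ) : Ideal (MvPolynomial (Fin n) ℝ) :=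
  Ideal.span ((fun j => MvPolynomial.aeval (fun i => (X i : MvPolynomial (Fin n) ℝ) ^ 2)
    (MvPolynomial.esymm (Fin n) ℝ j)) '' Set.Icc 1 n)

lemma geom_aux {R : Type*} [CommRing R] (a : R) :
    (PowerSeries.mk (fun k => a ^ k)) * (1 - PowerSeries.C a * PowerSeries.X) = 1 := by
  ext k
  rw [mul_sub, mul_one, ← mul_assoc, map_sub]
  cases k with
  | zero => simp
  | succ k =>
    rw [PowerSeries.coeff_succ_mul_X, PowerSeries.coeff_mul_C]
    simp [pow_succ, PowerSeries.coeff_one]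

lemma sym_aux {ι R : Type*} [DecidableEq ι] [CommRing R] (S : Finset ι) (y : ι → R) (m : ℕ) :
    ∑ μ : Sym {i // i ∈ S} m, ((μ : Multiset {i // i ∈ S}).map (fun i : {i // i ∈ S} => y (i : ι))).prod =
      PowerSeries.coeff m (∏ i ∈ S, PowerSeries.mk (fun k => y i ^ k)) := by
  rw [PowerSeries.coeff_prod, ← Finset.sum_coe_sort (Finset.finsuppAntidiag S m)]
  refine Fintype.sum_equiv (Finset.finsuppAntidiagEquiv S m).symm _ _ fun μ => ?_
  rw [← Finset.prod_coe_sort S, Finset.prod_multiset_map_count]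
  simp only [PowerSeries.coeff_mk, Finset.finsuppAntidiagEquiv_symm_apply_apply]
  apply Finset.prod_subset (Finset.subset_univ (μ : Multiset {i // i ∈ S}).toFinset)
  intro i _ hi
  rw [Multiset.count_eq_zero.2 (by simpa using hi), pow_zero]

lemma prod_aux {ι R : Type*} [DecidableEq ι] [CommRing R] (S : Finset ι) (y : ι → R) :
    (∏ i ∈ S, (1 - PowerSeries.C (y i) * PowerSeries.X) : PowerSeries R) =
      ∑ j ∈ Finset.range (S.card + 1),
        PowerSeries.C (∑ t ∈ Finset.powersetCard j S, ∏ i ∈ t, y i) * (-PowerSeries.X) ^ j := by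
  have : ∀ i ∈ S, (1 - PowerSeries.C (y i) * PowerSeries.X : PowerSeries R) =
      1 + PowerSeries.C (y i) * (-PowerSeries.X) := fun i _ => by ring
  rw [Finset.prod_congr rfl this, Finset.prod_one_add, Finset.sum_powerset]
  refine Finset.sum_congr rfl fun j _ => ?_
  rw [map_sum, Finset.sum_mul]
  refine Finset.sum_congr rfl fun t ht => ?_
  rw [Finset.prod_mul_distrib, Finset.prod_const, (Finset.mem_powersetCard.1 ht).2, map_prod]

lemma coeff_aux {ι R : Type*} [DecidableEq ι] [CommRing R] (S : Finset ι) (y : ι → R) (m : ℕ)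
    (hm : S.card < m) :
    PowerSeries.coeff m (∏ i ∈ S, (1 - PowerSeries.C (y i) * PowerSeries.X) : PowerSeries R)
      = 0 := by
  rw [prod_aux, map_sum]
  refine Finset.sum_eq_zero fun j hj => ?_
  rw [PowerSeries.coeff_C_mul, neg_pow, ← map_one (PowerSeries.C (R := R)), ← map_neg, ← map_pow,
    PowerSeries.coeff_C_mul, PowerSeries.coeff_X_pow, if_neg, mul_zero, mul_zero]
  have := Finset.mem_range.1 hj
  omega

/-- For `1 ≤ p ≤ n`, the complete homogeneous symmetric polynomial `h_{n-p+1}`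
evaluated at the squares `x_{n-p+1}², …, xₙ²` lies in the ideal `J`.  Here
`x_i` (for `1 ≤ i ≤ n`) is the variable with index `i - 1` in `Fin n`, so the
variables `x_{n-p+1}, …, xₙ` are those with index `≥ n - p`. -/
theorem relation_in_ideal_sq (n : ℕ) (hn : 1 ≤ n) (p : ℕ) (hp1 : 1 ≤ p) (hpn : p ≤ n) :
    completeHomoSq n (Finset.univ.filter (fun i => n - p ≤ (i : ℕ))) (n - p + 1) ∈
      sqSymIdeal n := by
  classical
  set S : Finset (Fin n) := Finset.univ.filter (fun i => n - p ≤ (i : ℕ)) with hS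
  let q := Ideal.Quotient.mk (sqSymIdeal n)
  let y : Fin n → MvPolynomial (Fin n) ℝ ⧸ sqSymIdeal n := fun i => q (X i ^ 2)
  have hcard : Sᶜ.card = n - p := by
    have : Sᶜ = Finset.univ.filter (fun i : Fin n => (i : ℕ) < n - p) := by
      ext i
      simp only [hS, Finset.mem_compl, Finset.mem_filter, Finset.mem_univ, true_and, not_le]
    rw [this, Fin.card_filter_val_lt]
    omega
  have hall : (∏ i, (1 - PowerSeries.C (y i) * PowerSeries.X) : PowerSeries _) = 1 := by
    rw [prod_aux, Finset.sum_range_succ', Finset.sum_eq_zero]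
    · simp
    · intro j hj
      have hj' : j < n := by simpa using hj
      have : (∑ t ∈ Finset.powersetCard (j + 1) Finset.univ, ∏ i ∈ t, y i) = 0 := by
        have h : q (MvPolynomial.aeval (fun i => (X i : MvPolynomial (Fin n) ℝ) ^ 2)
            (MvPolynomial.esymm (Fin n) ℝ (j + 1))) = 0 :=
          Ideal.Quotient.eq_zero_iff_mem.2
            (Ideal.subset_span ⟨j + 1, ⟨by omega, by omega⟩, rfl⟩)
        simpa only [MvPolynomial.esymm, map_sum, map_prod, MvPolynomial.aeval_X] using h
      rw [this, map_zero, zero_mul]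
  have hH : (∏ i ∈ S, PowerSeries.mk (fun k => y i ^ k)) =
      ∏ i ∈ Sᶜ, (1 - PowerSeries.C (y i) * PowerSeries.X) := by
    calc _ = (∏ i ∈ S, PowerSeries.mk (fun k => y i ^ k)) *
          ∏ i, (1 - PowerSeries.C (y i) * PowerSeries.X) := by rw [hall, mul_one]
      _ = _ := by
        rw [← Finset.prod_mul_prod_compl S, ← mul_assoc, ← Finset.prod_mul_distrib,
          Finset.prod_congr rfl fun i _ => geom_aux (y i), Finset.prod_const_one, one_mul]
  rw [← Ideal.Quotient.eq_zero_iff_mem]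
  have key := sym_aux S y (n - p + 1)
  rw [hH, coeff_aux _ _ _ (by omega)] at key
  rw [← key, completeHomoSq, map_sum]
  refine Finset.sum_congr rfl fun μ _ => ?_
  rw [map_multiset_prod, Multiset.map_map]
  simp only [Multiset.bind_def, Multiset.pure_def, Multiset.bind_singleton, Multiset.map_map]
  rfl
end

section
/- For every n ≥ 1, every q with 1 ≤ q ≤ n, and every integer m ≥ q, the complete homogeneous symmetric polynomial h_m evaluated at the squares x_q², x_{q+1}², …, xₙ² belongs to the ideal J. -/
open MvPolynomial

theorem aux_geom {A : Type*} [CommRing A] (a : A) :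
    (PowerSeries.mk fun k => a ^ k) * (1 - PowerSeries.C a * PowerSeries.X) = 1 := by
  ext k
  rw [mul_sub, mul_one, map_sub, mul_comm (PowerSeries.C a), ← mul_assoc, PowerSeries.coeff_mul_C]
  cases k with
  | zero => simp
  | succ k => simp [PowerSeries.coeff_succ_mul_X, pow_succ, PowerSeries.coeff_one]

theorem aux_h {A ι : Type*} [CommRing A] [Fintype ι] [DecidableEq ι] (y : ι → A) (m : ℕ) :
    PowerSeries.coeff m (∏ i, PowerSeries.mk fun k => y i ^ k) =
      ∑ μ : Sym ι m, ((μ : Multiset ι).map y).prod := by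
  rw [PowerSeries.coeff_prod]
  simp only [PowerSeries.coeff_mk]
  symm
  refine Finset.sum_bij (fun μ _ => ((Sym.equivNatSum ι m μ : _) : ι →₀ ℕ)) ?_ ?_ ?_ ?_
  · intro μ _
    have := (Sym.equivNatSum ι m μ).2
    rw [Finsupp.sum_fintype _ _ (by simp)] at this
    exact Finset.mem_finsuppAntidiag.2 ⟨this, Finset.subset_univ _⟩
  · intro a _ b _ h
    exact (Sym.equivNatSum ι m).injective (Subtype.ext h)
  · intro l hl
    refine ⟨(Sym.equivNatSum ι m).symm ⟨l, ?_⟩, Finset.mem_univ _, by simp⟩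
    rw [Finsupp.sum_fintype _ _ (by simp)]
    simpa [Finset.mem_finsuppAntidiag] using hl
  · intro μ _
    rw [Finset.prod_multiset_map_count]
    simp only [Sym.coe_equivNatSum_apply_apply]
    refine Finset.prod_subset (Finset.subset_univ _) ?_
    intro i _ hi
    rw [Multiset.count_eq_zero_of_notMem (by simpa using hi), pow_zero]

theorem aux_e {A ι : Type*} [CommRing A] [Fintype ι] (y : ι → A)
    (h : ∀ j, 1 ≤ j → j ≤ Fintype.card ι →
      ∑ t ∈ Finset.powersetCard j (Finset.univ : Finset ι), ∏ i ∈ t, y i = 0) :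
    ∏ i, (1 - PowerSeries.C (y i) * PowerSeries.X) = 1 := by
  simp only [sub_eq_add_neg]
  rw [Finset.prod_one_add, Finset.sum_powerset]
  rw [Finset.sum_range_succ']
  rw [Finset.sum_eq_zero]
  · simp
  · intro j hj
    have h' := h (j + 1) (by omega) (by simpa [Nat.succ_le_iff] using hj)
    have : ∀ t ∈ Finset.powersetCard (j+1) (Finset.univ : Finset ι),
        ∏ i ∈ t, -(PowerSeries.C (y i) * PowerSeries.X) =
        PowerSeries.C (∏ i ∈ t, y i) * (-PowerSeries.X) ^ (j+1) := by
      intro t ht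
      rw [← (Finset.mem_powersetCard.1 ht).2, map_prod, ← Finset.prod_const,
        ← Finset.prod_mul_distrib]
      exact Finset.prod_congr rfl fun i _ => by ring
    rw [Finset.sum_congr rfl this, ← Finset.sum_mul, ← map_sum, h']
    simp

theorem aux_deg {A ι : Type*} [CommRing A] (y : ι → A) (T : Finset ι) :
    ∀ m, T.card < m →
    PowerSeries.coeff m (∏ i ∈ T, (1 - PowerSeries.C (y i) * PowerSeries.X)) = 0 := by
  classical
  induction T using Finset.induction_on with
  | empty => intro m hm; simp [PowerSeries.coeff_one] at *; omega
  | insert a T ha ih =>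
    intro m hm
    rw [Finset.card_insert_of_notMem ha] at hm
    obtain ⟨m, rfl⟩ : ∃ k, m = k + 1 := ⟨m - 1, by omega⟩
    rw [Finset.prod_insert ha, sub_mul, one_mul, map_sub, ih _ (by omega), mul_assoc,
      PowerSeries.coeff_C_mul, PowerSeries.coeff_succ_X_mul, ih _ (by omega)]
    simp

/-- For `1 ≤ q ≤ n` and every `m ≥ q`, the complete homogeneous symmetric
polynomial `h_m` evaluated at the squares `x_q², x_{q+1}², …, xₙ²` lies in the
ideal `J`.  Here `x_i` is the variable with index `i - 1` in `Fin n`, so the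
variables `x_q, …, xₙ` are those with index `≥ q - 1`. -/
theorem completeHomoSq_tail_in_ideal (n : ℕ) (hn : 1 ≤ n) (q : ℕ) (hq1 : 1 ≤ q)
    (hqn : q ≤ n) (m : ℕ) (hm : q ≤ m) :
    completeHomoSq n (Finset.univ.filter (fun i => q - 1 ≤ (i : ℕ))) m ∈
      sqSymIdeal n := by
  classical
  rw [← Ideal.Quotient.eq_zero_iff_mem]
  set S : Finset (Fin n) := Finset.univ.filter (fun i => q - 1 ≤ (i : ℕ)) with hS
  set φ := Ideal.Quotient.mk (sqSymIdeal n) with hφ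
  set y : Fin n → MvPolynomial (Fin n) ℝ ⧸ sqSymIdeal n := fun i => φ (X i ^ 2) with hy
  have hc : φ (completeHomoSq n S m) =
      ∑ μ : Sym {i // i ∈ S} m, ((μ : Multiset {i // i ∈ S}).map (fun i : {i // i ∈ S} => y i)).prod := by
    rw [completeHomoSq, map_sum]
    refine Finset.sum_congr rfl fun μ _ => ?_
    rw [map_multiset_prod, Multiset.map_map]
    simp only [Multiset.bind_def, Multiset.pure_def, Multiset.bind_singleton, Multiset.map_map]
    rfl
  rw [hc, ← aux_h (fun i : {i // i ∈ S} => y i) m]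
  rw [Finset.prod_coe_sort S (fun i => PowerSeries.mk fun k => y i ^ k)]
  have h1 : ∏ i, (1 - PowerSeries.C (y i) * PowerSeries.X) = 1 := by
    apply aux_e
    intro j hj1 hj2
    have hmem : aeval (fun i => (X i : MvPolynomial (Fin n) ℝ) ^ 2)
        (esymm (Fin n) ℝ j) ∈ sqSymIdeal n :=
      Ideal.subset_span ⟨j, ⟨hj1, by simpa using hj2⟩, rfl⟩
    rw [← Ideal.Quotient.eq_zero_iff_mem] at hmem
    rw [← hmem]
    simp [esymm, map_sum, map_prod, hy, hφ]
  have h2 : (∏ i ∈ S, PowerSeries.mk fun k => y i ^ k) *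
      ∏ i ∈ S, (1 - PowerSeries.C (y i) * PowerSeries.X) = 1 := by
    rw [← Finset.prod_mul_distrib]
    exact Finset.prod_eq_one fun i _ => aux_geom _
  have h3 : (∏ i ∈ S, PowerSeries.mk fun k => y i ^ k) =
      ∏ i ∈ Sᶜ, (1 - PowerSeries.C (y i) * PowerSeries.X) := by
    rw [← Finset.prod_mul_prod_compl S] at h1
    exact left_inv_eq_right_inv h2 h1
  rw [h3]
  apply aux_deg
  have : Sᶜ.card ≤ (Finset.range (q - 1)).card := by
    refine Finset.card_le_card_of_injOn (fun i => (i : ℕ)) ?_ (fun a _ b _ h => Fin.ext h)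
    intro i hi
    simp [hS] at hi ⊢
    omega
  rw [Finset.card_range] at this
  omega
end
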